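/- arXiv:2204.08146 — 3 statements merged into one kernel-verified Lean document; each statement's English description precedes it below -/
import Mathlib

section
/- One-dimensional Gaussian mechanism: Let X be a measurable space and f : (Fin n → X) → ℝ satisfy |f(D) − f(D')| ≤ S for all adjacent datasets D, D', where S > 0. Fix 0 < ε ≤ 1, 0 < δ < 1, and set σ = (S/ε)·√(2·log(1.25/δ)). Then the mechanism D ↦ gaussianReal (f D) σ², i.e. outputting f(D) plus N(0, σ²) Gaussian noise, is (ε, δ)-differentially private. -/
open MeasureTheory ProbabilityTheory

/-- Two datasets are adjacent if they differ in at most one coordinate. -/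
def Adjacent {X : Type*} {n : ℕ} (D D' : Fin n → X) : Prop :=
  ∃ i : Fin n, ∀ j : Fin n, j ≠ i → D j = D' j

/-- A mechanism `M` is `(ε, δ)`-differentially private w.r.t. one-coordinate
adjacency if for all adjacent datasets and all measurable events `A`,
`M D A ≤ exp ε * M D' A + δ`. -/
def IsDP {X : Type*} [MeasurableSpace X] {n : ℕ} {Ω : Type*} [MeasurableSpace Ω]
    (M : (Fin n → X) → Measure Ω) (ε δ : ℝ) : Prop :=
  ∀ D D' : Fin n → X, Adjacent D D' → ∀ A : Set Ω, MeasurableSet A →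
    M D A ≤ ENNReal.ofReal (Real.exp ε) * M D' A + ENNReal.ofReal δ

/-- A pointwise bound between Gaussian densities on `A` gives the same bound between the measures
of `A`. -/
lemma gaussianReal_le_mul_of_pdf_le {m m' C : ℝ} {v : NNReal} (hv : v ≠ 0) (hC : 0 ≤ C)
    {A : Set ℝ} (hA : MeasurableSet A)
    (h : ∀ x ∈ A, gaussianPDFReal m v x ≤ C * gaussianPDFReal m' v x) :
    gaussianReal m v A ≤ ENNReal.ofReal C * gaussianReal m' v A := by
  rw [gaussianReal_apply _ hv, gaussianReal_apply _ hv,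
    ← lintegral_const_mul _ (measurable_gaussianPDF m' v)]
  refine setLIntegral_mono' hA fun x hx => ?_
  rw [gaussianPDF, gaussianPDF, ← ENNReal.ofReal_mul hC]
  exact ENNReal.ofReal_le_ofReal (h x hx)

lemma gaussianPDFReal_le_exp_mul {m m' r : ℝ} {v : NNReal} (hv : v ≠ 0) {x : ℝ}
    (h : (x - m') ^ 2 - (x - m) ^ 2 ≤ 2 * v * r) :
    gaussianPDFReal m v x ≤ Real.exp r * gaussianPDFReal m' v x := by
  have hv' : (0 : ℝ) < v := by positivity
  rw [gaussianPDFReal, gaussianPDFReal, mul_left_comm, ← Real.exp_add]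
  gcongr
  rw [← sub_nonneg]
  have : r + -(x - m') ^ 2 / (2 * v) - -(x - m) ^ 2 / (2 * v)
      = (2 * v * r - ((x - m') ^ 2 - (x - m) ^ 2)) / (2 * v) := by
    field_simp
    ring
  rw [this]
  exact div_nonneg (by linarith) (by positivity)

lemma gaussianReal_Ioi_zero_le : gaussianReal 0 1 (Set.Ioi 0) ≤ ENNReal.ofReal (1 / 2) := by
  have hsymm : gaussianReal 0 1 (Set.Iio 0) = gaussianReal 0 1 (Set.Ioi 0) := by
    conv_rhs => rw [← neg_zero, ← gaussianReal_map_neg]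
    rw [Measure.map_apply measurable_neg measurableSet_Ioi]
    congr 1
    ext x
    simp
  have hsum : gaussianReal 0 1 (Set.Iio 0) + gaussianReal 0 1 (Set.Ioi 0) ≤ 1 := by
    have hdisj : Disjoint (Set.Iio (0 : ℝ)) (Set.Ioi 0) :=
      Set.disjoint_left.2 fun _ h h' => lt_asymm (Set.mem_Iio.1 h) h'
    rw [← measure_union hdisj measurableSet_Ioi]
    exact prob_le_one
  rw [hsymm, ← two_mul] at hsum
  rw [one_div, ENNReal.ofReal_inv_of_pos two_pos, ENNReal.ofReal_ofNat,
    ENNReal.le_inv_iff_mul_le, mul_comm]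
  exact hsum

lemma gaussianReal_Ioi_le_of_nonneg {t : ℝ} (ht : 0 ≤ t) :
    gaussianReal 0 1 (Set.Ioi t) ≤ ENNReal.ofReal (1 / 2 * Real.exp (-t ^ 2 / 2)) := by
  have hshift : gaussianReal 0 1 (Set.Ioi t) = gaussianReal (-t) 1 (Set.Ioi 0) := by
    rw [← zero_sub t, ← gaussianReal_map_sub_const,
      Measure.map_apply (by fun_prop) measurableSet_Ioi]
    congr 1
    ext x
    simp
  rw [hshift, mul_comm, ENNReal.ofReal_mul (Real.exp_pos _).le]
  refine (gaussianReal_le_mul_of_pdf_le (m' := 0) one_ne_zero (Real.exp_pos (-t ^ 2 / 2)).le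
    measurableSet_Ioi fun x hx => gaussianPDFReal_le_exp_mul one_ne_zero ?_).trans
    (mul_le_mul_right gaussianReal_Ioi_zero_le _)
  have : 0 ≤ x * t := mul_nonneg (le_of_lt hx) ht
  push_cast
  nlinarith

lemma gaussianPDFReal_zero_one_le_one (x : ℝ) : gaussianPDFReal 0 1 x ≤ 1 := by
  rw [gaussianPDFReal]
  refine mul_le_one₀ (inv_le_one_of_one_le₀ (Real.one_le_sqrt.2 ?_)) (Real.exp_pos _).le
    (Real.exp_le_one_iff.2 ?_)
  · push_cast
    linarith [Real.pi_gt_three]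
  · push_cast
    nlinarith [sq_nonneg (x - 0)]

lemma gaussianReal_Ioi_le_of_nonpos {t : ℝ} (ht : t ≤ 0) :
    gaussianReal 0 1 (Set.Ioi t) ≤ ENNReal.ofReal (1 / 2 - t) := by
  have hIoc : gaussianReal 0 1 (Set.Ioc t 0) ≤ ENNReal.ofReal (-t) := by
    rw [gaussianReal_apply _ one_ne_zero]
    calc ∫⁻ x in Set.Ioc t 0, gaussianPDF 0 1 x
        ≤ ∫⁻ _ in Set.Ioc t 0, 1 := by
          refine lintegral_mono fun x => ?_
          rw [gaussianPDF]
          exact ENNReal.ofReal_le_one.2 (gaussianPDFReal_zero_one_le_one x)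
      _ = ENNReal.ofReal (-t) := by simp
  rw [← Set.Ioc_union_Ioi_eq_Ioi ht, sub_eq_neg_add,
    ENNReal.ofReal_add (neg_nonneg.2 ht) (by norm_num)]
  exact (measure_union_le _ _).trans (add_le_add hIoc gaussianReal_Ioi_zero_le)

lemma gaussianReal_Ioi_sub_inv_le {c : ℝ} (hc : 0 < c)
    (hc1 : 1.25 * Real.exp (-c ^ 2 / 2) < 1) :
    gaussianReal 0 1 (Set.Ioi (c - 1 / (2 * c))) ≤
      ENNReal.ofReal (1.25 * Real.exp (-c ^ 2 / 2)) := by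
  have hmul : 2 * c * (c - 1 / (2 * c)) = 2 * c ^ 2 - 1 := by field_simp
  set t := c - 1 / (2 * c) with ht
  have hexp := Real.add_one_le_exp (-c ^ 2 / 2)
  rcases le_total 0 t with h | h
  · refine (gaussianReal_Ioi_le_of_nonneg h).trans (ENNReal.ofReal_le_ofReal ?_)
    have hsq : c ^ 2 - 1 ≤ t ^ 2 := by
      have : t = c - 1 / (2 * c) := ht
      have h' : t ^ 2 = c ^ 2 - 1 + (1 / (2 * c)) ^ 2 := by
        rw [this]
        field_simp
        ring
      nlinarith [sq_nonneg (1 / (2 * c))]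
    have h1 : Real.exp (-t ^ 2 / 2) ≤ Real.exp (1 / 2) * Real.exp (-c ^ 2 / 2) := by
      rw [← Real.exp_add]
      exact Real.exp_le_exp.2 (by linarith)
    have h2 : Real.exp (1 / 2) ≤ 2 := by
      have h3 : Real.exp (1 / 2) * Real.exp (1 / 2) = Real.exp 1 := by
        rw [← Real.exp_add]
        norm_num
      nlinarith [Real.exp_one_lt_d9, Real.exp_pos (1 / 2)]
    nlinarith [Real.exp_pos (-c ^ 2 / 2)]
  · refine (gaussianReal_Ioi_le_of_nonpos h).trans (ENNReal.ofReal_le_ofReal ?_)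
    have hc2 : c ^ 2 ≤ 1 / 2 := by nlinarith
    have hc3 : 0.4 ≤ c ^ 2 := by norm_num at *; linarith
    have hc4 : 0.6 ≤ c := by norm_num at *; nlinarith
    have ht4 : -0.4 ≤ t := by norm_num at *; nlinarith
    norm_num at *
    linarith

/-- The privacy loss between two Gaussians is at most `ε` below the tail threshold. -/
lemma privacy_loss_le {w σ ε c z : ℝ} (hw : 0 ≤ w) (hσ : 0 < σ) (hc : 0 < c)
    (hε1 : ε ≤ 1) (hwc : w * c ≤ σ * ε) (hz : z ≤ c - 1 / (2 * c)) :
    2 * (w * σ * z) + w ^ 2 ≤ 2 * σ ^ 2 * ε := by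
  have hz' : 2 * c * z ≤ 2 * c ^ 2 - 1 := by
    have := mul_le_mul_of_nonneg_left hz (by positivity : 0 ≤ 2 * c)
    have h2 : 2 * c * (c - 1 / (2 * c)) = 2 * c ^ 2 - 1 := by field_simp
    linarith
  have hwc1 : w * c ≤ σ := by nlinarith
  have h1 : w * σ * (2 * c * z) ≤ w * σ * (2 * c ^ 2 - 1) :=
    mul_le_mul_of_nonneg_left hz' (by positivity)
  have h2 : w * (w * c) ≤ w * σ := mul_le_mul_of_nonneg_left hwc1 hw
  have h3 : 2 * σ * c * (w * c) ≤ 2 * σ * c * (σ * ε) :=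
    mul_le_mul_of_nonneg_left hwc (by positivity)
  have : c * (2 * (w * σ * z) + w ^ 2) ≤ c * (2 * σ ^ 2 * ε) := by linarith
  exact le_of_mul_le_mul_left this hc

lemma gaussianReal_eq_map_standard (m s : ℝ) :
    gaussianReal m (s ^ 2).toNNReal = (gaussianReal 0 1).map (fun z => s * z + m) := by
  have : (fun z : ℝ => s * z + m) = (fun y => y + m) ∘ (fun z => s * z) := rfl
  rw [this, ← Measure.map_map (by fun_prop) (by fun_prop),
    gaussianReal_map_const_mul, gaussianReal_map_add_const]
  congr 1
  · simp
  · ext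
    simp [sq_nonneg]

/-- One-dimensional Gaussian mechanism: adding `N(0, σ²)` noise with
`σ = (S/ε)·√(2·log(1.25/δ))` to a real-valued query of sensitivity `S`
is `(ε, δ)`-differentially private. -/
theorem gaussian_mechanism_one_dim
    {X : Type*} [MeasurableSpace X] {n : ℕ}
    (f : (Fin n → X) → ℝ) (S ε δ : ℝ)
    (hS : 0 < S) (hε : 0 < ε) (hε1 : ε ≤ 1) (hδ0 : 0 < δ) (hδ1 : δ < 1)
    (hsens : ∀ D D' : Fin n → X, Adjacent D D' → |f D - f D'| ≤ S)
    (σ : ℝ) (hσ : σ = (S / ε) * Real.sqrt (2 * Real.log (1.25 / δ))) :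
    IsDP (fun D => gaussianReal (f D) ((σ ^ 2).toNNReal)) ε δ := by
  intro D D' hadj A hA
  have hd := hsens D D' hadj
  set m := f D
  set m' := f D'
  set c := Real.sqrt (2 * Real.log (1.25 / δ)) with hcdef
  have hlog : 0 < Real.log (1.25 / δ) :=
    Real.log_pos ((one_lt_div hδ0).2 (hδ1.trans (by norm_num)))
  have hc : 0 < c := Real.sqrt_pos.2 (by positivity)
  have hδ : 1.25 * Real.exp (-c ^ 2 / 2) = δ := by
    have hexp : -c ^ 2 / 2 = -Real.log (1.25 / δ) := by
      rw [hcdef, Real.sq_sqrt (by positivity)]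
      ring
    rw [hexp, Real.exp_neg, Real.exp_log (by positivity)]
    field_simp
  have hσ0 : 0 < σ := hσ ▸ by positivity
  have hσε : σ * ε = S * c := by
    rw [hσ]
    field_simp
  have hv : (σ ^ 2).toNNReal ≠ 0 := (Real.toNNReal_pos.2 (by positivity)).ne'
  have hvσ : ((σ ^ 2).toNNReal : ℝ) = σ ^ 2 := Real.coe_toNNReal _ (by positivity)
  obtain ⟨s, hs2, hsd⟩ : ∃ s : ℝ, s ^ 2 = σ ^ 2 ∧ s * (m - m') = |m - m'| * σ := by
    rcases abs_cases (m - m') with ⟨h, -⟩ | ⟨h, -⟩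
    · exact ⟨σ, rfl, by rw [h, mul_comm]⟩
    · exact ⟨-σ, by ring, by rw [h]; ring⟩
  let B : Set ℝ := {x | 2 * σ ^ 2 * ε < (x - m') ^ 2 - (x - m) ^ 2}
  have hB : MeasurableSet B := measurableSet_lt (by fun_prop) (by fun_prop)
  have hbad : gaussianReal m (σ ^ 2).toNNReal B ≤ ENNReal.ofReal δ := by
    rw [← hs2, gaussianReal_eq_map_standard, Measure.map_apply (by fun_prop) hB, ← hδ]
    refine (measure_mono fun z hz => ?_).trans (gaussianReal_Ioi_sub_inv_le hc (hδ ▸ hδ1))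
    by_contra hle
    have hloss := privacy_loss_le (abs_nonneg (m - m')) hσ0 hc hε1
      (hσε ▸ mul_le_mul_of_nonneg_right hd hc.le) (not_lt.1 hle)
    rw [sq_abs, ← hsd] at hloss
    have hz' : 2 * σ ^ 2 * ε < (s * z + m - m') ^ 2 - (s * z + m - m) ^ 2 := hz
    linarith
  have hgood : gaussianReal m (σ ^ 2).toNNReal (A \ B) ≤
      ENNReal.ofReal (Real.exp ε) * gaussianReal m' (σ ^ 2).toNNReal (A \ B) :=
    gaussianReal_le_mul_of_pdf_le hv (Real.exp_pos ε).le (hA.diff hB) fun x hx =>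
      gaussianPDFReal_le_exp_mul hv (by rw [hvσ]; exact not_lt.1 hx.2)
  calc gaussianReal m (σ ^ 2).toNNReal A
      ≤ gaussianReal m (σ ^ 2).toNNReal (A \ B ∪ B) :=
        measure_mono (by rw [Set.sdiff_union_self]; exact Set.subset_union_left)
    _ ≤ gaussianReal m (σ ^ 2).toNNReal (A \ B) + gaussianReal m (σ ^ 2).toNNReal B :=
        measure_union_le _ _
    _ ≤ ENNReal.ofReal (Real.exp ε) * gaussianReal m' (σ ^ 2).toNNReal A + ENNReal.ofReal δ :=
        add_le_add (hgood.trans (mul_le_mul_right (measure_mono Set.sdiff_subset) _)) hbad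
end

section
/- Multivariate Gaussian mechanism: Let X be a measurable space and f : (Fin n → X) → (Fin B → ℝ) have ℓ2-sensitivity at most S > 0, i.e. ‖f(D) − f(D')‖₂ ≤ S for all adjacent datasets D, D', where ‖x‖₂ = √(Σᵢ x(i)²). Fix 0 < ε ≤ 1, 0 < δ < 1, and set σ = (S/ε)·√(2·log(1.25/δ)). Then the mechanism M(D) obtained by adding independent N(0, σ²) noise to each of the B coordinates of f(D) — i.e. the pushforward of the product measure ⨂_{i ∈ Fin B} gaussianReal 0 σ² under z ↦ f(D) + z — is (ε, δ)-differentially private. -/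
open MeasureTheory ProbabilityTheory

/-- The Euclidean (ℓ2) norm on `Fin B → ℝ`. -/
noncomputable def l2norm {B : ℕ} (x : Fin B → ℝ) : ℝ :=
  Real.sqrt (∑ i, x i ^ 2)

open scoped ENNReal NNReal

/-- The lower integral of a product of functions of separate coordinates is the product of the
lower integrals. -/
lemma lintegral_pi_prod_eval {ι : Type*} [Fintype ι] {α : ι → Type*}
    [∀ i, MeasurableSpace (α i)] (μ : ∀ i, Measure (α i)) [∀ i, IsProbabilityMeasure (μ i)]
    (g : ∀ i, α i → ℝ≥0∞) (hg : ∀ i, Measurable (g i)) :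
    ∫⁻ z, ∏ i, g i (z i) ∂(Measure.pi μ) = ∏ i, ∫⁻ x, g i x ∂(μ i) := by
  rw [lintegral_prod_eq_prod_lintegral_of_indepFun Finset.univ (fun i (z : ∀ i, α i) => g i (z i))
    (iIndepFun_pi fun i => (hg i).aemeasurable) fun i => (hg i).comp (measurable_pi_apply i)]
  refine Finset.prod_congr rfl fun i _ => ?_
  exact (measurePreserving_eval μ i).lintegral_comp (hg i)

/-- A product of probability measures with densities has the product density. -/
lemma pi_withDensity {ι : Type*} [Fintype ι] {α : ι → Type*}
    [∀ i, MeasurableSpace (α i)] (μ : ∀ i, Measure (α i)) [∀ i, IsProbabilityMeasure (μ i)]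
    (g : ∀ i, α i → ℝ≥0∞) (hg : ∀ i, Measurable (g i))
    [∀ i, SigmaFinite ((μ i).withDensity (g i))] :
    Measure.pi (fun i => (μ i).withDensity (g i)) =
      (Measure.pi μ).withDensity fun z => ∏ i, g i (z i) := by
  refine Measure.pi_eq fun s hs => ?_
  rw [withDensity_apply _ (MeasurableSet.univ_pi hs), ← lintegral_indicator
    (MeasurableSet.univ_pi hs)]
  have hind : (Set.univ.pi s).indicator (fun z => ∏ i, g i (z i)) =
      fun z => ∏ i, (s i).indicator (g i) (z i) := by
    funext z
    by_cases hz : z ∈ Set.univ.pi s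
    · rw [Set.indicator_of_mem hz]
      exact Finset.prod_congr rfl fun i _ => (Set.indicator_of_mem (hz i trivial) _).symm
    · rw [Set.indicator_of_notMem hz]
      obtain ⟨i, hi⟩ : ∃ i, z i ∉ s i := by simpa [Set.mem_univ_pi] using hz
      exact (Finset.prod_eq_zero (Finset.mem_univ i) (Set.indicator_of_notMem hi _)).symm
  rw [hind, lintegral_pi_prod_eval μ _ fun i => (hg i).indicator (hs i)]
  refine Finset.prod_congr rfl fun i _ => ?_
  rw [lintegral_indicator (hs i), withDensity_apply _ (hs i)]

/-- The logarithm of the density of `N(m, v)` with respect to `N(m', v)`. -/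
noncomputable def gaussianLogRatio (m m' v x : ℝ) : ℝ :=
  (m - m') / v * x + (m' ^ 2 - m ^ 2) / (2 * v)

lemma measurable_gaussianLogRatio (m m' v : ℝ) : Measurable (gaussianLogRatio m m' v) := by
  unfold gaussianLogRatio
  fun_prop

lemma gaussianReal_eq_withDensity_gaussianReal (m m' : ℝ) {v : ℝ≥0} (hv : v ≠ 0) :
    gaussianReal m v = (gaussianReal m' v).withDensity
      fun x => ENNReal.ofReal (Real.exp (gaussianLogRatio m m' v x)) := by
  have hv' : (v : ℝ) ≠ 0 := by exact_mod_cast hv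
  rw [gaussianReal_of_var_ne_zero m hv, gaussianReal_of_var_ne_zero m' hv,
    ← withDensity_mul _ (measurable_gaussianPDF m' v)
      (measurable_gaussianLogRatio m m' v).exp.ennreal_ofReal]
  congr 1
  funext x
  rw [Pi.mul_apply, gaussianPDF, gaussianPDF, ← ENNReal.ofReal_mul (gaussianPDFReal_nonneg _ _ _),
    gaussianPDFReal, gaussianPDFReal, mul_assoc (_)⁻¹, ← Real.exp_add, gaussianLogRatio]
  congr 3
  field_simp
  ring

/-- Exponential moments of the privacy loss between two Gaussians of equal variance. -/
lemma lintegral_exp_mul_gaussianLogRatio (m m' b : ℝ) {v : ℝ≥0} (hv : v ≠ 0) :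
    ∫⁻ x, ENNReal.ofReal (Real.exp (b * gaussianLogRatio m m' v x)) ∂(gaussianReal m' v) =
      ENNReal.ofReal (Real.exp ((b ^ 2 - b) / (2 * v) * (m - m') ^ 2)) := by
  have hv' : (v : ℝ) ≠ 0 := by exact_mod_cast hv
  have hsplit : ∀ x, Real.exp (b * gaussianLogRatio m m' v x) =
      Real.exp (b * ((m' ^ 2 - m ^ 2) / (2 * v))) * Real.exp (b * ((m - m') / v) * x) := by
    intro x
    rw [← Real.exp_add, gaussianLogRatio]
    congr 1
    ring
  simp_rw [hsplit]
  rw [← ofReal_integral_eq_lintegral_ofReal ((integrable_exp_mul_gaussianReal _).const_mul _)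
    (Filter.Eventually.of_forall fun x => by positivity), integral_const_mul]
  have hmgf := congrFun (mgf_fun_id_gaussianReal (μ := m') (v := v)) (b * ((m - m') / v))
  rw [mgf] at hmgf
  rw [hmgf, ← Real.exp_add]
  congr 2
  field_simp
  ring

/-- Hockey-stick bound: `e^ℓ` exceeds `e^ε` by at most a multiple of its `(1 + a)`-th power. -/
lemma exp_le_exp_add_exp_mul {a : ℝ} (ha : 0 ≤ a) (l ε : ℝ) :
    Real.exp l ≤ Real.exp ε + Real.exp (-(a * ε)) / (1 + a) * Real.exp ((1 + a) * l) := by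
  have h1 := Real.add_one_le_exp (a * (l - ε))
  have h2 := mul_le_mul_of_nonneg_left (Real.add_one_le_exp (-(l - ε))) ha
  have h3 : 0 ≤ Real.exp (-(l - ε)) := (Real.exp_pos _).le
  have key : (1 + a) * (1 - Real.exp (-(l - ε))) ≤ Real.exp (a * (l - ε)) := by nlinarith
  have e1 : Real.exp l * Real.exp (-(l - ε)) = Real.exp ε := by
    rw [← Real.exp_add]; congr 1; ring
  have e2 : Real.exp (-(a * ε)) / (1 + a) * Real.exp ((1 + a) * l) =
      Real.exp l * (Real.exp (a * (l - ε)) / (1 + a)) := by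
    rw [div_mul_eq_mul_div, ← Real.exp_add, mul_div_assoc', ← Real.exp_add]
    congr 2; ring
  have key' : 1 - Real.exp (-(l - ε)) ≤ Real.exp (a * (l - ε)) / (1 + a) := by
    rw [le_div_iff₀ (by linarith)]
    linarith
  have := mul_le_mul_of_nonneg_left key' (Real.exp_pos l).le
  rw [e2]
  linarith

/-- Approximate indistinguishability of two isotropic Gaussian measures, with the additive term
given by a moment of the privacy loss. -/
lemma pi_gaussianReal_le_exp_mul_add {ι : Type*} [Fintype ι] (m m' : ι → ℝ) {v : ℝ≥0}
    (hv : v ≠ 0) {a : ℝ} (ha : 0 ≤ a) (ε : ℝ) {A : Set (ι → ℝ)} (hA : MeasurableSet A) :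
    Measure.pi (fun i => gaussianReal (m i) v) A ≤
      ENNReal.ofReal (Real.exp ε) * Measure.pi (fun i => gaussianReal (m' i) v) A +
      ENNReal.ofReal (Real.exp (-(a * ε)) / (1 + a) *
        Real.exp ((a ^ 2 + a) / (2 * v) * ∑ i, (m i - m' i) ^ 2)) := by
  set Q := Measure.pi (fun i => gaussianReal (m' i) v) with hQ
  set l : (ι → ℝ) → ℝ := fun z => ∑ i, gaussianLogRatio (m i) (m' i) v (z i) with hl
  have hlm : Measurable l := Finset.measurable_sum _ fun i _ =>
    (measurable_gaussianLogRatio _ _ _).comp (measurable_pi_apply i)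
  have hdens : Measure.pi (fun i => gaussianReal (m i) v) =
      Q.withDensity fun z => ENNReal.ofReal (Real.exp (l z)) := by
    have hfun : (fun i => gaussianReal (m i) v) = fun i => (gaussianReal (m' i) v).withDensity
        fun x => ENNReal.ofReal (Real.exp (gaussianLogRatio (m i) (m' i) v x)) :=
      funext fun i => gaussianReal_eq_withDensity_gaussianReal (m i) (m' i) hv
    have (i : ι) : SigmaFinite ((gaussianReal (m' i) v).withDensity
        fun x => ENNReal.ofReal (Real.exp (gaussianLogRatio (m i) (m' i) v x))) := by
      rw [← gaussianReal_eq_withDensity_gaussianReal (m i) (m' i) hv]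
      infer_instance
    rw [hfun, pi_withDensity _ _ fun i =>
      (measurable_gaussianLogRatio (m i) (m' i) v).exp.ennreal_ofReal]
    congr 1
    funext z
    rw [← ENNReal.ofReal_prod_of_nonneg fun i _ => (Real.exp_pos _).le, ← Real.exp_sum]
  have hmoment : ∫⁻ z, ENNReal.ofReal (Real.exp ((1 + a) * l z)) ∂Q =
      ENNReal.ofReal (Real.exp ((a ^ 2 + a) / (2 * v) * ∑ i, (m i - m' i) ^ 2)) := by
    have hprod : ∀ z, ENNReal.ofReal (Real.exp ((1 + a) * l z)) = ∏ i, ENNReal.ofReal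
        (Real.exp ((1 + a) * gaussianLogRatio (m i) (m' i) v (z i))) := by
      intro z
      rw [← ENNReal.ofReal_prod_of_nonneg fun i _ => (Real.exp_pos _).le, ← Real.exp_sum,
        Finset.mul_sum]
    simp_rw [hprod]
    rw [hQ, lintegral_pi_prod_eval _
      (fun i x => ENNReal.ofReal (Real.exp ((1 + a) * gaussianLogRatio (m i) (m' i) v x)))
      fun i => ((measurable_gaussianLogRatio (m i) (m' i) v).const_mul _).exp.ennreal_ofReal]
    simp_rw [lintegral_exp_mul_gaussianLogRatio _ _ _ hv]
    rw [← ENNReal.ofReal_prod_of_nonneg fun i _ => (Real.exp_pos _).le, ← Real.exp_sum,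
      ← Finset.mul_sum]
    congr 4
    ring
  have hc : 0 ≤ Real.exp (-(a * ε)) / (1 + a) := by positivity
  rw [hdens, withDensity_apply _ hA]
  calc ∫⁻ z in A, ENNReal.ofReal (Real.exp (l z)) ∂Q
      ≤ ∫⁻ z in A, (ENNReal.ofReal (Real.exp ε) + ENNReal.ofReal (Real.exp (-(a * ε)) / (1 + a)) *
          ENNReal.ofReal (Real.exp ((1 + a) * l z))) ∂Q := by
        refine lintegral_mono fun z => ?_
        rw [← ENNReal.ofReal_mul hc, ← ENNReal.ofReal_add (Real.exp_pos _).le (by positivity)]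
        exact ENNReal.ofReal_le_ofReal (exp_le_exp_add_exp_mul ha _ _)
    _ = ENNReal.ofReal (Real.exp ε) * Q A + ENNReal.ofReal (Real.exp (-(a * ε)) / (1 + a)) *
          ∫⁻ z in A, ENNReal.ofReal (Real.exp ((1 + a) * l z)) ∂Q := by
        rw [lintegral_add_left measurable_const, setLIntegral_const,
          lintegral_const_mul _ (hlm.const_mul _).exp.ennreal_ofReal]
    _ ≤ _ := by
        rw [ENNReal.ofReal_mul hc, ← hmoment]
        gcongr
        exact Measure.restrict_le_self

lemma map_add_pi_gaussianReal {ι : Type*} [Fintype ι] (m : ι → ℝ) (v : ℝ≥0) :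
    (Measure.pi fun _ : ι => gaussianReal 0 v).map (fun z => m + z) =
      Measure.pi fun i => gaussianReal (m i) v := by
  have h : ∀ i, (gaussianReal 0 v).map (fun x => m i + x) = gaussianReal (m i) v := fun i => by
    rw [gaussianReal_map_const_add, zero_add]
  have (i : ι) : SigmaFinite ((gaussianReal 0 v).map (fun x => m i + x)) := by
    rw [h]
    infer_instance
  have hpi := Measure.pi_map_pi (μ := fun _ : ι => gaussianReal 0 v) (f := fun i x => m i + x)
    fun i => (measurable_const_add (m i)).aemeasurable
  simp_rw [h] at hpi
  exact hpi

/-- The additive privacy loss for the classical calibration of the noise is at most `δ`. -/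
lemma exp_div_mul_exp_le {ε δ : ℝ} (hε : 0 < ε) (hε1 : ε ≤ 1) (hδ0 : 0 < δ) (hδ1 : δ < 1) :
    Real.exp (ε / 2 - Real.log (1.25 / δ)) / (1 + 2 * Real.log (1.25 / δ) / ε) ≤ δ := by
  have hpos : (0 : ℝ) < 1.25 / δ := by positivity
  have hL : (1 : ℝ) / 5 ≤ Real.log (1.25 / δ) := by
    have h1 := Real.one_sub_inv_le_log_of_pos (show (0 : ℝ) < 1.25 by norm_num)
    have h2 := Real.log_le_log (by norm_num) (show (1.25 : ℝ) ≤ 1.25 / δ by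
      rw [le_div_iff₀ hδ0]; linarith)
    norm_num at h1 h2 ⊢
    linarith
  have hden : (7 : ℝ) / 5 ≤ 1 + 2 * Real.log (1.25 / δ) / ε := by
    have : 2 * Real.log (1.25 / δ) ≤ 2 * Real.log (1.25 / δ) / ε := by
      rw [le_div_iff₀ hε]; nlinarith
    linarith
  have hexp : Real.exp (ε / 2) ≤ 7 / 4 := by
    have h1 : Real.exp (ε / 2) * Real.exp (ε / 2) ≤ 3 := by
      rw [← Real.exp_add, add_halves]
      exact (Real.exp_le_exp.mpr hε1).trans (by linarith [Real.exp_one_lt_d9])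
    nlinarith [Real.exp_pos (ε / 2)]
  rw [Real.exp_sub, Real.exp_log hpos, div_le_iff₀ (by linarith)]
  calc Real.exp (ε / 2) / (1.25 / δ) = δ * (Real.exp (ε / 2) / 1.25) := by field_simp
    _ ≤ _ := by
        gcongr
        rw [div_le_iff₀ (by norm_num)]
        linarith

/-- Multivariate Gaussian mechanism: adding independent `N(0, σ²)` noise, with
`σ = (S/ε)·√(2·log(1.25/δ))`, to each coordinate of a `Fin B → ℝ`-valued query
of ℓ2-sensitivity `S` is `(ε, δ)`-differentially private. -/
theorem gaussian_mechanism_multivariate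
    {X : Type*} [MeasurableSpace X] {n B : ℕ}
    (f : (Fin n → X) → (Fin B → ℝ)) (S ε δ : ℝ)
    (hS : 0 < S) (hε : 0 < ε) (hε1 : ε ≤ 1) (hδ0 : 0 < δ) (hδ1 : δ < 1)
    (hsens : ∀ D D' : Fin n → X, Adjacent D D' → l2norm (f D - f D') ≤ S)
    (σ : ℝ) (hσ : σ = (S / ε) * Real.sqrt (2 * Real.log (1.25 / δ))) :
    IsDP (fun D =>
      Measure.map (fun z : Fin B → ℝ => f D + z)
        (Measure.pi fun _ : Fin B => gaussianReal 0 ((σ ^ 2).toNNReal))) ε δ := by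
  intro D D' hD A hA
  have hL : 0 < Real.log (1.25 / δ) := Real.log_pos (by rw [lt_div_iff₀ hδ0]; linarith)
  have hσ2 : σ ^ 2 = S ^ 2 / ε ^ 2 * (2 * Real.log (1.25 / δ)) := by
    rw [hσ, mul_pow, div_pow, Real.sq_sqrt (by positivity)]
  have hσpos : 0 < σ ^ 2 := by rw [hσ2]; positivity
  have hv : (σ ^ 2).toNNReal ≠ 0 := (Real.toNNReal_pos.mpr hσpos).ne'
  have hsum : ∑ i, (f D i - f D' i) ^ 2 ≤ S ^ 2 := (Real.sqrt_le_left hS.le).mp (hsens D D' hD)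
  beta_reduce
  rw [map_add_pi_gaussianReal, map_add_pi_gaussianReal]
  set a := 2 * Real.log (1.25 / δ) / ε with ha
  have ha0 : 0 ≤ a := by positivity
  refine (pi_gaussianReal_le_exp_mul_add (f D) (f D') hv ha0 ε hA).trans ?_
  gcongr
  rw [Real.coe_toNNReal _ hσpos.le]
  calc Real.exp (-(a * ε)) / (1 + a) *
        Real.exp ((a ^ 2 + a) / (2 * σ ^ 2) * ∑ i, (f D i - f D' i) ^ 2)
      ≤ Real.exp (-(a * ε)) / (1 + a) * Real.exp ((a ^ 2 + a) / (2 * σ ^ 2) * S ^ 2) := by gcongr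
    _ = Real.exp (ε / 2 - Real.log (1.25 / δ)) / (1 + a) := by
        rw [div_mul_eq_mul_div, ← Real.exp_add, hσ2, ha]
        congr 2
        field_simp
        ring
    _ ≤ δ := exp_div_mul_exp_le hε hε1 hδ0 hδ1
end

section
/- The required Gaussian noise scale in GetPrivAttn is strictly decreasing in the padding ratio: Fix S > 0, ε > 0, and δ > 0, and for p ∈ [0, 1) with 1.25·(1 − p) > δ define σ(p) = S·√(2·log(1.25·(1 − p)/δ)) / log((exp ε − p)/(1 − p)). Then for all 0 ≤ p₁ < p₂ < 1 with 1.25·(1 − p₂) ≥ δ, one has σ(p₂) < σ(p₁); i.e. a larger padding probability strictly reduces the noise magnitude required for the same (ε, δ) guarantee. -/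
open Real

/-- The required Gaussian noise scale in GetPrivAttn,
`σ(p) = S·√(2·log(1.25·(1 − p)/δ)) / log((exp ε − p)/(1 − p))`,
is strictly decreasing in the padding ratio `p`. -/
theorem noise_scale_strictly_decreasing_in_padding
    (S ε δ : ℝ) (hS : 0 < S) (hε : 0 < ε) (hδ : 0 < δ)
    (σ : ℝ → ℝ)
    (hσ : ∀ p : ℝ, σ p =
      S * Real.sqrt (2 * Real.log (1.25 * (1 - p) / δ)) /
        Real.log ((Real.exp ε - p) / (1 - p))) :
    ∀ p₁ p₂ : ℝ, 0 ≤ p₁ → p₁ < p₂ → p₂ < 1 → δ ≤ 1.25 * (1 - p₂) →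
      σ p₂ < σ p₁ := by
  intro p₁ p₂ _ h12 h2 hδ2
  have hexp : 1 < Real.exp ε := Real.one_lt_exp_iff.mpr hε
  have hq₁ : 0 < 1 - p₁ := by linarith
  have hq₂ : 0 < 1 - p₂ := by linarith
  have hratio₁ : 1 < (Real.exp ε - p₁) / (1 - p₁) := by
    rw [one_lt_div hq₁]
    linarith
  have hratio : (Real.exp ε - p₁) / (1 - p₁) < (Real.exp ε - p₂) / (1 - p₂) := by
    rw [div_lt_div_iff₀ hq₁ hq₂]
    nlinarith [mul_pos (sub_pos.mpr hexp) (sub_pos.mpr h12)]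
  have hden₁ : 0 < Real.log ((Real.exp ε - p₁) / (1 - p₁)) := Real.log_pos hratio₁
  have hden : Real.log ((Real.exp ε - p₁) / (1 - p₁)) <
      Real.log ((Real.exp ε - p₂) / (1 - p₂)) :=
    Real.log_lt_log (by linarith) hratio
  have harg₂ : 1 ≤ 1.25 * (1 - p₂) / δ := by rwa [one_le_div hδ]
  have harg : 1.25 * (1 - p₂) / δ < 1.25 * (1 - p₁) / δ := by
    gcongr
  have hlog₂ : 0 ≤ Real.log (1.25 * (1 - p₂) / δ) := Real.log_nonneg harg₂
  have hlog : Real.log (1.25 * (1 - p₂) / δ) < Real.log (1.25 * (1 - p₁) / δ) :=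
    Real.log_lt_log (by linarith) harg
  have hnum : S * Real.sqrt (2 * Real.log (1.25 * (1 - p₂) / δ)) <
      S * Real.sqrt (2 * Real.log (1.25 * (1 - p₁) / δ)) :=
    mul_lt_mul_of_pos_left (Real.sqrt_lt_sqrt (by linarith) (by linarith)) hS
  rw [hσ, hσ]
  exact div_lt_div₀ hnum hden.le (by positivity) hden₁
end
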